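/- arXiv:1112.1183 — 2 statements merged into one kernel-verified Lean document; each statement's English description precedes it below -/
import Mathlib

section
/- Let β, β' > 1, let a_1 a_2 ⋯ be the (−β)-expansion of −β/(β+1) and a'_1 a'_2 ⋯ the (−β')-expansion of −β'/(β'+1). Suppose a_1 a_2 ⋯ <_alt a'_1 a'_2 ⋯ and that a'_1 a'_2 ⋯ is purely periodic with minimal period of odd length 2ℓ'+1, i.e. a' = (a'_1 ⋯ a'_{2ℓ'+1})^∞. Then a_1 a_2 ⋯ ≤_alt (a'_1 ⋯ a'_{2ℓ'} (a'_{2ℓ'+1} − 1) 0)^∞. -/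
open Filter Set

/-- The (−β)-transformation on [−β/(β+1), 1/(β+1)). -/
noncomputable def negBetaT (β : ℝ) (x : ℝ) : ℝ := -β * x - ⌊β / (β + 1) - β * x⌋

/-- The digits of the (−β)-expansion of x; `negBetaDigit β x n` is ε_{n+1}(x). -/
noncomputable def negBetaDigit (β : ℝ) (x : ℝ) (n : ℕ) : ℤ :=
  ⌊β / (β + 1) - β * ((negBetaT β)^[n] x)⌋

/-- The (−β)-expansion of the left endpoint −β/(β+1); index n represents a_{n+1}. -/
noncomputable def negBetaExp (β : ℝ) (n : ℕ) : ℤ := negBetaDigit β (-β / (β + 1)) n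

/-- `b` is the (−β)-expansion of `x`. -/
def IsNegBetaExpOf (β : ℝ) (x : ℝ) (b : ℕ → ℤ) : Prop :=
  x ∈ Set.Ico (-β / (β + 1)) (1 / (β + 1)) ∧ ∀ n, b n = negBetaDigit β x n

/-- Alternating lexicographic strict order (0-based indexing: index k corresponds
to position k+1, so `Even k` means odd position). -/
def AltLt (x y : ℕ → ℤ) : Prop :=
  ∃ k, (∀ i, i < k → x i = y i) ∧ (if Even k then x k < y k else y k < x k)

/-- Alternating lexicographic order. -/
def AltLe (x y : ℕ → ℤ) : Prop := AltLt x y ∨ x = y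

def phiW : ℕ → List ℕ
  | 1 => [1, 0, 0]
  | _ => [1]

/-- `uWord n` is φ^n(1), where φ(1) = 100, φ(0) = 1. -/
def uWord : ℕ → List ℕ
  | 0 => [1]
  | n + 1 => (uWord n).flatMap phiW

/-- The sequence u = 100111001001001110011⋯ starting with φ^n(1) for all n. -/
def uSeq (n : ℕ) : ℤ := ((uWord (n + 1)).getD n 0 : ℕ)

/-- Condition (G): every shifted sequence is ≤_alt the sequence itself. -/
def CondG (a : ℕ → ℤ) : Prop := ∀ k, 1 ≤ k → AltLe (fun n => a (n + k)) a

/-- Condition (L): a >_alt u. -/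
def CondL (a : ℕ → ℤ) : Prop := AltLt uSeq a

/-- The periodic sequence (w)^∞. -/
def perSeq (w : List ℤ) : ℕ → ℤ := fun n => w.getD (n % w.length) 0

/-- `a` is an infinite concatenation of blocks from `S`. -/
def IsInfConcat (S : Set (List ℤ)) (a : ℕ → ℤ) : Prop :=
  ∃ w : ℕ → List ℤ, (∀ n, w n ∈ S) ∧
    ∀ N i, i < (((List.range N).map w).flatten).length →
      (((List.range N).map w).flatten).getD i 0 = a i

/-- Condition (A1). -/
def CondA1 (a : ℕ → ℤ) : Prop :=
  ∀ k, 1 ≤ k → AltLt uSeq (perSeq ((List.range k).map a)) →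
    IsInfConcat {(List.range k).map a, (List.range (k - 1)).map a ++ [a (k - 1) - 1, 0]} a →
    a = perSeq ((List.range k).map a)

/-- Condition (A2). -/
def CondA2 (a : ℕ → ℤ) : Prop :=
  ∀ k, 1 ≤ k → AltLt uSeq (perSeq ((List.range (k - 1)).map a ++ [a (k - 1) + 1])) →
    ¬ IsInfConcat {(List.range k).map a ++ [0], (List.range (k - 1)).map a ++ [a (k - 1) + 1]} a

/-- The cylinder set I_{b_1⋯b_n}. -/
def cylinder (β : ℝ) (w : List ℤ) : Set ℝ :=
  {x | x ∈ Set.Ico (-β / (β + 1)) (1 / (β + 1)) ∧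
    ∀ i, i < w.length → negBetaDigit β x i = w.getD i 0}

/-- L_{β,n}: the number of words of length n with nonempty cylinder. -/
noncomputable def Lnum (β : ℝ) (n : ℕ) : ℕ :=
  Set.ncard {w : List ℤ | w.length = n ∧ (cylinder β w).Nonempty}

/-- L'_{β,n}: the number of words of length n whose cylinder is an interval of
positive length. -/
noncomputable def Lnum' (β : ℝ) (n : ℕ) : ℕ :=
  Set.ncard {w : List ℤ | w.length = n ∧
    ∃ c d : ℝ, c < d ∧ Set.Ioo c d ⊆ cylinder β w ∧ cylinder β w ⊆ Set.Icc c d}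

/-- P_n(x) = (−x)^n + Σ_{j=1}^n (a_j+1)(−x)^{n−j}. -/
noncomputable def Pn (a : ℕ → ℤ) (n : ℕ) (x : ℝ) : ℝ :=
  (-x) ^ n + ∑ j ∈ Finset.range n, ((a j : ℝ) + 1) * (-x) ^ (n - 1 - j)

/-- J_n = {x > 1 : P_j(x) ∈ [0,1] for all 1 ≤ j ≤ n}. -/
def Jn (a : ℕ → ℤ) (n : ℕ) : Set ℝ :=
  {x | 1 < x ∧ ∀ j, 1 ≤ j → j ≤ n → Pn a j x ∈ Set.Icc (0 : ℝ) 1}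

theorem AltLt.trans {x y z : ℕ → ℤ} (hxy : AltLt x y) (hyz : AltLt y z) : AltLt x z := by
  obtain ⟨k, hk, hk'⟩ := hxy
  obtain ⟨m, hm, hm'⟩ := hyz
  rcases lt_trichotomy k m with h | h | h
  · refine ⟨k, fun i hi => (hk i hi).trans (hm i (hi.trans h)), ?_⟩
    rwa [← hm k h]
  · subst h
    refine ⟨k, fun i hi => (hk i hi).trans (hm i hi), ?_⟩
    split_ifs at hk' hm' ⊢ <;> omega
  · refine ⟨m, fun i hi => (hk i (hi.trans h)).trans (hm i hi), ?_⟩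
    rwa [hk m h]

theorem AltLe.trans_lt {x y z : ℕ → ℤ} (hxy : AltLe x y) (hyz : AltLt y z) : AltLt x z := by
  rcases hxy with h | rfl
  · exact h.trans hyz
  · exact hyz

theorem AltLt.irrefl (x : ℕ → ℤ) : ¬ AltLt x x := by
  rintro ⟨k, -, hk⟩
  split_ifs at hk <;> omega

theorem altLe_or_altLt (x y : ℕ → ℤ) : AltLe x y ∨ AltLt y x := by
  classical
  by_cases hxy : x = y
  · exact Or.inl (Or.inr hxy)
  have hex : ∃ k, x k ≠ y k := Function.ne_iff.mp hxy
  have hmin : ∀ i, i < Nat.find hex → x i = y i := fun i hi => not_not.mp (Nat.find_min hex hi)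
  have hne := Nat.find_spec hex
  by_cases he : Even (Nat.find hex)
  · rcases lt_or_gt_of_ne hne with h | h
    · exact Or.inl (Or.inl ⟨_, hmin, by rwa [if_pos he]⟩)
    · exact Or.inr ⟨_, fun i hi => (hmin i hi).symm, by rwa [if_pos he]⟩
  · rcases lt_or_gt_of_ne hne with h | h
    · exact Or.inr ⟨_, fun i hi => (hmin i hi).symm, by rwa [if_neg he]⟩
    · exact Or.inl (Or.inl ⟨_, hmin, by rwa [if_neg he]⟩)

/-- A common prefix of odd length reverses the alternating order. -/
theorem AltLt.of_shift_odd {x y : ℕ → ℤ} {p : ℕ} (hp : Odd p) (hpre : ∀ i, i < p → x i = y i)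
    (h : AltLt (fun n => x (n + p)) (fun n => y (n + p))) : AltLt y x := by
  obtain ⟨k, hk, hk'⟩ := h
  refine ⟨k + p, fun i hi => ?_, ?_⟩
  · rcases lt_or_ge i p with hip | hip
    · exact (hpre i hip).symm
    · have := hk (i - p) (by omega)
      simpa [Nat.sub_add_cancel hip] using this.symm
  · by_cases he : Even k
    · rw [if_neg (by simpa using he.add_odd hp)]
      simpa [he] using hk'
    · rw [if_pos ((Nat.not_even_iff_odd.mp he).add_odd hp)]
      simpa [he] using hk'

theorem negBetaDigit_add (β x : ℝ) (n k : ℕ) :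
    negBetaDigit β x (n + k) = negBetaDigit β ((negBetaT β)^[k] x) n := by
  simp only [negBetaDigit, Function.iterate_add_apply]

theorem negBetaT_mem_Ico {β : ℝ} (hβ : 1 < β) (x : ℝ) :
    negBetaT β x ∈ Set.Ico (-β / (β + 1)) (1 / (β + 1)) := by
  have h1 := Int.floor_le (β / (β + 1) - β * x)
  have h2 := Int.lt_floor_add_one (β / (β + 1) - β * x)
  have h3 : 1 / (β + 1) = 1 - β / (β + 1) := by field_simp; ring
  rw [Set.mem_Ico, neg_div, h3, negBetaT]
  constructor <;> linarith

theorem iterate_negBetaT_mem_Ico {β x : ℝ} (hβ : 1 < β)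
    (hx : x ∈ Set.Ico (-β / (β + 1)) (1 / (β + 1))) (k : ℕ) :
    (negBetaT β)^[k] x ∈ Set.Ico (-β / (β + 1)) (1 / (β + 1)) := by
  cases k with
  | zero => exact hx
  | succ k =>
    rw [Function.iterate_succ_apply']
    exact negBetaT_mem_Ico hβ _

theorem negBetaDigit_nonneg {β x : ℝ} (hβ : 1 < β)
    (hx : x ∈ Set.Ico (-β / (β + 1)) (1 / (β + 1))) (k : ℕ) : 0 ≤ negBetaDigit β x k := by
  have h := (iterate_negBetaT_mem_Ico hβ hx k).2
  have h2 : β * (negBetaT β)^[k] x ≤ β * (1 / (β + 1)) :=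
    mul_le_mul_of_nonneg_left h.le (by linarith)
  rw [negBetaDigit, Int.floor_nonneg]
  rw [mul_one_div] at h2
  linarith

theorem left_endpoint_mem_Ico {β : ℝ} (hβ : 1 < β) :
    -β / (β + 1) ∈ Set.Ico (-β / (β + 1)) (1 / (β + 1)) :=
  ⟨le_rfl, div_lt_div_of_pos_right (by linarith) (by linarith)⟩

theorem iterate_negBetaT_sub (β x y : ℝ) (k : ℕ)
    (h : ∀ i, i < k → negBetaDigit β x i = negBetaDigit β y i) :
    (negBetaT β)^[k] x - (negBetaT β)^[k] y = (-β) ^ k * (x - y) := by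
  induction k with
  | zero => simp
  | succ k ih =>
    have hk := h k (Nat.lt_succ_self k)
    have ih' := ih fun i hi => h i (hi.trans (Nat.lt_succ_self k))
    simp only [negBetaDigit] at hk
    rw [Function.iterate_succ_apply', Function.iterate_succ_apply', negBetaT, negBetaT, hk, pow_succ]
    linear_combination (-β) * ih'

/-- The (−β)-expansion reverses the order. -/
theorem altLe_negBetaDigit_of_le {β x y : ℝ} (hβ : 1 < β) (hxy : x ≤ y) :
    AltLe (negBetaDigit β y) (negBetaDigit β x) := by
  refine (altLe_or_altLt _ _).resolve_right ?_
  rintro ⟨k, hk, hk'⟩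
  have hsub := iterate_negBetaT_sub β x y k hk
  have hpow : 0 < β ^ k := by positivity
  by_cases he : Even k
  · rw [if_pos he] at hk'
    rw [he.neg_pow] at hsub
    refine hk'.not_ge (Int.floor_le_floor ?_)
    nlinarith [mul_nonneg hpow.le (sub_nonneg.mpr hxy)]
  · rw [if_neg he] at hk'
    rw [(Nat.not_even_iff_odd.mp he).neg_pow] at hsub
    refine hk'.not_ge (Int.floor_le_floor ?_)
    nlinarith [mul_nonneg hpow.le (sub_nonneg.mpr hxy)]

theorem altLe_negBetaExp_shift {β : ℝ} (hβ : 1 < β) (k : ℕ) :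
    AltLe (fun n => negBetaExp β (n + k)) (negBetaExp β) := by
  simp only [negBetaExp, negBetaDigit_add]
  exact altLe_negBetaDigit_of_le hβ (iterate_negBetaT_mem_Ico hβ (left_endpoint_mem_Ico hβ) k).1

theorem altLe_of_altLt_periodic {a a' c : ℕ → ℤ} {ℓ : ℕ} (hshift : ∀ k, AltLe (fun n => a (n + k)) a)
    (hnonneg : ∀ n, 0 ≤ a n) (hlt : AltLt a a') (hper : ∀ n, a' (n + (2 * ℓ + 1)) = a' n)
    (hc : ∀ n, c n = c (n % (2 * ℓ + 2))) (hinit : ∀ i, i < 2 * ℓ → c i = a' i)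
    (hlast : c (2 * ℓ) = a' (2 * ℓ) - 1) (hzero : c (2 * ℓ + 1) = 0) : AltLe a c := by
  refine (altLe_or_altLt _ _).resolve_right ?_
  rintro ⟨m, hm, hm'⟩
  obtain ⟨q, r, hr, rfl⟩ : ∃ q r, r < 2 * ℓ + 2 ∧ m = r + (2 * ℓ + 2) * q :=
    ⟨m / (2 * ℓ + 2), m % (2 * ℓ + 2), Nat.mod_lt _ (by omega), (Nat.mod_add_div _ _).symm⟩
  set t : ℕ → ℤ := fun n => a (n + (2 * ℓ + 2) * q) with ht
  have hta' : AltLt t a' := (hshift _).trans_lt hlt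
  have hcr : ∀ i, i < 2 * ℓ + 2 → c (i + (2 * ℓ + 2) * q) = c i := fun i hi => by
    rw [hc, Nat.add_mul_mod_self_left, Nat.mod_eq_of_lt hi]
  have hpre : ∀ i, i < r → c i = t i := fun i hi => by
    rw [← hcr i (hi.trans hr)]
    exact hm _ (by omega)
  have heven : Even (r + (2 * ℓ + 2) * q) ↔ Even r := by
    simp [Nat.even_add]
  have hdiff : if Even r then c r < t r else t r < c r := by
    simpa only [heven, hcr r hr] using hm'
  rcases lt_trichotomy r (2 * ℓ) with h | rfl | h
  · refine AltLt.irrefl a' (AltLt.trans ⟨r, fun i hi => ?_, ?_⟩ hta')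
    · rw [← hinit i (hi.trans h), hpre i hi]
    · rwa [← hinit r h]
  · rw [if_pos (even_two_mul ℓ), hlast] at hdiff
    have hpre' : ∀ i, i < 2 * ℓ → a' i = t i := fun i hi => (hinit i hi).symm.trans (hpre i hi)
    rcases (show a' (2 * ℓ) ≤ t (2 * ℓ) by omega).lt_or_eq with h | h
    · refine AltLt.irrefl a' (AltLt.trans ⟨2 * ℓ, hpre', ?_⟩ hta')
      rwa [if_pos (even_two_mul ℓ)]
    · refine AltLt.irrefl a' (AltLt.trans (AltLt.of_shift_odd (p := 2 * ℓ + 1) ⟨ℓ, rfl⟩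
        (fun i hi => ?_) ?_) hta')
      · rcases (Nat.lt_succ_iff.mp hi).lt_or_eq with h' | rfl
        · exact (hpre' i h').symm
        · exact h.symm
      · simp only [hper, ht, add_assoc]
        exact (hshift _).trans_lt hlt
  · obtain rfl : r = 2 * ℓ + 1 := by omega
    rw [if_neg (by simp), hzero] at hdiff
    exact hdiff.not_ge (hnonneg _)

/-- if a <_alt a' and a' is purely periodic with minimal odd
period length 2ℓ'+1, then a ≤_alt (a'_1⋯a'_{2ℓ'}(a'_{2ℓ'+1}−1)0)^∞. -/
theorem stmt_10 (β β' : ℝ) (hβ : 1 < β) (hβ' : 1 < β') (a a' : ℕ → ℤ)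
    (ha : ∀ n, a n = negBetaExp β n) (ha' : ∀ n, a' n = negBetaExp β' n)
    (hlt : AltLt a a') (ℓ' : ℕ)
    (hper : ∀ n, a' n = a' (n % (2 * ℓ' + 1)))
    (hmin : ∀ m, m < ℓ' → ¬ ∀ n, a' n = a' (n % (2 * m + 1))) :
    AltLe a (perSeq ((List.range (2 * ℓ')).map a' ++ [a' (2 * ℓ') - 1, 0])) := by
  obtain rfl : a = negBetaExp β := funext ha
  have hlen : ((List.range (2 * ℓ')).map a' ++ [a' (2 * ℓ') - 1, 0]).length = 2 * ℓ' + 2 := by simp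
  refine altLe_of_altLt_periodic (ℓ := ℓ') (altLe_negBetaExp_shift hβ)
    (negBetaDigit_nonneg hβ (left_endpoint_mem_Ico hβ)) hlt (fun n => ?_) (fun n => ?_)
    (fun i hi => ?_) ?_ ?_
  · rw [hper, Nat.add_mod_right, ← hper]
  · simp only [perSeq, hlen, Nat.mod_mod]
  · rw [perSeq, hlen, Nat.mod_eq_of_lt (by omega)]
    simp [List.getD_eq_getElem?_getD, List.getElem?_append_left, hi]
  · rw [perSeq, hlen, Nat.mod_eq_of_lt (by omega)]
    simp [List.getD_eq_getElem?_getD]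
  · rw [perSeq, hlen, Nat.mod_eq_of_lt (by omega)]
    simp [List.getD_eq_getElem?_getD]
end

section
/- Let a_1 a_2 ⋯ be a sequence of non-negative integers satisfying (G) and (L). Then for every n ≥ 1 the set J_n is a nonempty interval, and inf J_n = 1 if and only if a_1 ⋯ a_n = u_1 ⋯ u_n. -/
open Filter Set

/-! ### The recursion satisfied by the polynomials -/

lemma Pn_zero (a : ℕ → ℤ) (x : ℝ) : Pn a 0 x = 1 := by simp [Pn]

lemma Pn_succ (a : ℕ → ℤ) (n : ℕ) (x : ℝ) :
    Pn a (n + 1) x = (a n : ℝ) + 1 - x * Pn a n x := by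
  have h : ∑ j ∈ Finset.range n, ((a j : ℝ) + 1) * (-x) ^ (n + 1 - 1 - j)
      = -x * ∑ j ∈ Finset.range n, ((a j : ℝ) + 1) * (-x) ^ (n - 1 - j) := by
    rw [Finset.mul_sum]
    refine Finset.sum_congr rfl fun j hj => ?_
    have hj' := Finset.mem_range.1 hj
    rw [show n + 1 - 1 - j = (n - 1 - j) + 1 by omega, pow_succ]
    ring
  unfold Pn
  rw [Finset.sum_range_succ, h]
  simp only [Nat.add_sub_cancel, Nat.sub_self, pow_zero]
  ring

lemma Pn_congr {a b : ℕ → ℤ} {n : ℕ} (h : ∀ i, i < n → a i = b i) (x : ℝ) :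
    Pn a n x = Pn b n x := by
  induction n with
  | zero => simp [Pn_zero]
  | succ n ih =>
    rw [Pn_succ, Pn_succ, ih fun i hi => h i (by omega), h n (by omega)]

lemma continuous_Pn (a : ℕ → ℤ) (n : ℕ) : Continuous (Pn a n) := by
  unfold Pn
  fun_prop

/-- Running the digits of `b` from an arbitrary starting value changes the result affinely. -/
lemma Pn_add_sub {a b : ℕ → ℤ} {p k : ℕ} (h : ∀ i, i < k → a (p + i) = b i) (x : ℝ) :
    Pn a (p + k) x = Pn b k x + (-x) ^ k * (Pn a p x - 1) := by
  induction k with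
  | zero => simp [Pn_zero]
  | succ k ih =>
    rw [← add_assoc, Pn_succ, Pn_succ, ih fun i hi => h i (by omega), h k (by omega)]
    ring

lemma eq_one_and_eq_zero_of_sub_eq {p q : ℝ} {d : ℤ} (hp : p ≤ 1) (hq : 0 ≤ q)
    (h : p - q = d) (hd : 0 < d) : p = 1 ∧ q = 0 := by
  have : (1 : ℝ) ≤ d := by exact_mod_cast hd
  constructor <;> linarith

/-! ### Uniqueness of closing parameters: the primitive case -/

section Contraction

variable {n : ℕ} {a : ℕ → ℤ} {f g : ℕ → ℝ} {x y c : ℝ}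

/-- `g` is dominated by `c` times `f` in all mutual distances and all distances to `0`. -/
def DistLe (n : ℕ) (f g : ℕ → ℝ) (c : ℝ) : Prop :=
  (∀ i, i < n → ∀ j, j < n → |g i - g j| ≤ c * |f i - f j|) ∧ ∀ i, i < n → g i ≤ c * f i

lemma DistLe.contract (hn : 1 ≤ n) (ha : ∀ i, 0 ≤ a i) (hx : 0 < x) (hy : 0 < y)
    (f0 : f 0 = 1) (g0 : g 0 = 1) (fn : f n = 1) (gn : g n = 1)
    (fs : ∀ i, f (i + 1) = a i + 1 - x * f i) (gs : ∀ i, g (i + 1) = a i + 1 - y * g i)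
    (fI : ∀ i, i ≤ n → f i ∈ Set.Icc (0 : ℝ) 1) (gI : ∀ i, i ≤ n → g i ∈ Set.Icc (0 : ℝ) 1)
    (h : DistLe n f g c) : DistLe n f g (c * (x / y)) := by
  obtain ⟨h1, h2⟩ := h
  have hc : 1 ≤ c := by simpa [f0, g0] using h2 0 (by omega)
  have wrap : ∀ i, i ≤ n → ∃ i', i' < n ∧ f i = f i' ∧ g i = g i' := by
    intro i hi
    rcases hi.lt_or_eq with hi | rfl
    · exact ⟨i, hi, rfl, rfl⟩
    · exact ⟨0, by omega, by rw [fn, f0], by rw [gn, g0]⟩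
  have h1' : ∀ i, i ≤ n → ∀ j, j ≤ n → |g i - g j| ≤ c * |f i - f j| := by
    intro i hi j hj
    obtain ⟨i', hi', e1, e2⟩ := wrap i hi
    obtain ⟨j', hj', e3, e4⟩ := wrap j hj
    rw [e1, e2, e3, e4]
    exact h1 i' hi' j' hj'
  have h2' : ∀ i, i ≤ n → g i ≤ c * f i := by
    intro i hi
    obtain ⟨i', hi', e1, e2⟩ := wrap i hi
    rw [e1, e2]
    exact h2 i' hi'
  have h3 : ∀ i, i ≤ n → 1 - g i ≤ c * (1 - f i) := by
    intro i hi
    have := h1' 0 (by omega) i hi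
    rw [f0, g0, abs_of_nonneg (by linarith [(gI i hi).2]),
      abs_of_nonneg (by linarith [(fI i hi).2])] at this
    exact this
  have scale : ∀ u v : ℝ, y * u ≤ c * (x * v) → u ≤ c * (x / y) * v := by
    intro u v huv
    rw [show c * (x / y) * v = c * (x * v) / y by ring, le_div_iff₀ hy]
    linarith
  have lt_case : ∀ i, i < n → ∀ j, j < n → a i < a j →
      |g i - g j| ≤ c * (x / y) * |f i - f j| := by
    intro i hi j hj hij
    apply scale
    have hd : (0 : ℝ) ≤ a j - a i - 1 := by
      have : ((a i + 1 : ℤ) : ℝ) ≤ a j := by exact_mod_cast hij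
      push_cast at this
      linarith
    have ef : x * (f j - f i) = (1 - f (j + 1)) + f (i + 1) + (a j - a i - 1) := by
      rw [fs, fs]; ring
    have eg : y * (g j - g i) = (1 - g (j + 1)) + g (i + 1) + (a j - a i - 1) := by
      rw [gs, gs]; ring
    have Fj := fI (j + 1) hj
    have Fi := fI (i + 1) hi
    have Gj := gI (j + 1) hj
    have Gi := gI (i + 1) hi
    have f_nonneg : 0 ≤ f j - f i := by
      have : 0 ≤ x * (f j - f i) := by rw [ef]; linarith [Fj.2, Fi.1]
      exact nonneg_of_mul_nonneg_right this hx
    have g_nonneg : 0 ≤ g j - g i := by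
      have : 0 ≤ y * (g j - g i) := by rw [eg]; linarith [Gj.2, Gi.1]
      exact nonneg_of_mul_nonneg_right this hy
    rw [abs_sub_comm, abs_sub_comm (f i), abs_of_nonneg f_nonneg, abs_of_nonneg g_nonneg, ef, eg]
    nlinarith [h3 (j + 1) hj, h2' (i + 1) hi, mul_nonneg (sub_nonneg.2 hc) hd]
  refine ⟨fun i hi j hj => ?_, fun i hi => scale _ _ ?_⟩
  · rcases lt_trichotomy (a i) (a j) with hij | hij | hij
    · exact lt_case i hi j hj hij
    · apply scale
      have ef : |f (i + 1) - f (j + 1)| = x * |f i - f j| := by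
        rw [fs, fs, hij, ← abs_of_pos hx, ← abs_mul, abs_of_pos hx, ← abs_neg]
        congr 1; ring
      have eg : |g (i + 1) - g (j + 1)| = y * |g i - g j| := by
        rw [gs, gs, hij, ← abs_of_pos hy, ← abs_mul, abs_of_pos hy, ← abs_neg]
        congr 1; ring
      rw [← ef, ← eg]
      exact h1' _ hi _ hj
    · rw [abs_sub_comm, abs_sub_comm (f i)]
      exact lt_case j hj i hi hij
  · have hai : (0 : ℝ) ≤ a i := by exact_mod_cast ha i
    have ef : x * f i = (1 - f (i + 1)) + a i := by rw [fs]; ring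
    have eg : y * g i = (1 - g (i + 1)) + a i := by rw [gs]; ring
    rw [ef, eg]
    nlinarith [h3 (i + 1) hi, mul_nonneg (sub_nonneg.2 hc) hai]

lemma exists_distLe (fI : ∀ i, i < n → 0 < f i) (hf : ∀ i, i < n → ∀ j, j < n → f i = f j → i = j)
    (g : ℕ → ℝ) : ∃ c, DistLe n f g c := by
  let S := ∑ i ∈ Finset.range n, ∑ j ∈ Finset.range n, |g i - g j| / |f i - f j|
  let T := ∑ i ∈ Finset.range n, |g i| / f i
  have hT : 0 ≤ T := Finset.sum_nonneg fun i hi =>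
    div_nonneg (abs_nonneg _) (fI i (Finset.mem_range.1 hi)).le
  have hS0 : ∀ i, 0 ≤ ∑ j ∈ Finset.range n, |g i - g j| / |f i - f j| := fun i =>
    Finset.sum_nonneg fun j _ => by positivity
  have hS : 0 ≤ S := Finset.sum_nonneg fun i _ => hS0 i
  refine ⟨S + T, fun i hi j hj => ?_, fun i hi => ?_⟩
  · by_cases hij : i = j
    · simp [hij]
    · have hpos : 0 < |f i - f j| := abs_pos.2 (sub_ne_zero.2 fun h => hij (hf i hi j hj h))
      rw [← div_le_iff₀ hpos]
      have e1 := Finset.single_le_sum (f := fun j => |g i - g j| / |f i - f j|)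
        (fun j _ => by positivity) (Finset.mem_range.2 hj)
      have e2 := Finset.single_le_sum
        (f := fun i => ∑ j ∈ Finset.range n, |g i - g j| / |f i - f j|)
        (fun i _ => hS0 i) (Finset.mem_range.2 hi)
      linarith
  · rw [← div_le_iff₀ (fI i hi)]
    have e1 := Finset.single_le_sum (f := fun i => |g i| / f i)
      (fun i hi => div_nonneg (abs_nonneg _) (fI i (Finset.mem_range.1 hi)).le)
      (Finset.mem_range.2 hi)
    have e2 : g i / f i ≤ |g i| / f i := div_le_div_of_nonneg_right (le_abs_self _) (fI i hi).le
    linarith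

end Contraction

/-- Two parameters cannot close up the same digit word when the orbit of the smaller one meets
`{0, 1}` only at the end. -/
lemma false_of_primitive_closing {a : ℕ → ℤ} (ha : ∀ i, 0 ≤ a i) {n : ℕ} (hn : 1 ≤ n) {x y : ℝ}
    (hx : 0 < x) (hxy : x < y) (xI : ∀ i, i ≤ n → Pn a i x ∈ Set.Icc (0 : ℝ) 1)
    (yI : ∀ i, i ≤ n → Pn a i y ∈ Set.Icc (0 : ℝ) 1) (xn : Pn a n x = 1) (yn : Pn a n y = 1)
    (prim : ∀ i, 1 ≤ i → i < n → Pn a i x ≠ 0 ∧ Pn a i x ≠ 1) : False := by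
  have hinj : ∀ i j, i < j → j < n → Pn a i x ≠ Pn a j x := by
    intro i j hij hj heq
    have key : ∀ k, j + k ≤ n → Pn a (i + k) x = Pn a (j + k) x := by
      intro k
      induction k with
      | zero => intro _; exact heq
      | succ k ih =>
        intro hk
        have e := ih (by omega)
        have hi := prim (i + k + 1) (by omega) (by omega)
        have Ii := xI (i + k + 1) (by omega)
        have Ij := xI (j + k + 1) (by omega)
        have e1 : Pn a (i + k + 1) x - Pn a (j + k + 1) x = ((a (i + k) - a (j + k) : ℤ) : ℝ) := by
          rw [Pn_succ, Pn_succ, e]; push_cast; ring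
        rcases lt_trichotomy (a (i + k) - a (j + k)) 0 with h | h | h
        · have := eq_one_and_eq_zero_of_sub_eq (d := -(a (i + k) - a (j + k))) Ij.2 Ii.1
            (by push_cast at e1 ⊢; linarith) (by omega)
          exact absurd this.2 hi.1
        · rw [h] at e1
          push_cast at e1
          rw [← add_assoc, ← add_assoc]
          linarith
        · exact absurd (eq_one_and_eq_zero_of_sub_eq Ii.2 Ij.1 e1 h).1 hi.2
    have := key (n - j) (by omega)
    rw [show j + (n - j) = n by omega, xn] at this
    exact (prim _ (by omega) (by omega)).2 this
  obtain ⟨c, hc⟩ := exists_distLe (n := n) (f := fun i => Pn a i x)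
    (fun i hi => by
      rcases Nat.eq_zero_or_pos i with rfl | hi'
      · simp [Pn_zero]
      · exact lt_of_le_of_ne (xI i hi.le).1 (prim i hi' hi).1.symm)
    (fun i hi j hj h => by
      rcases lt_trichotomy i j with hij | hij | hij
      · exact absurd h (hinj i j hij hj)
      · exact hij
      · exact absurd h.symm (hinj j i hij hi))
    (fun i => Pn a i y)
  have hall : ∀ k, DistLe n (fun i => Pn a i x) (fun i => Pn a i y) (c * (x / y) ^ k) := by
    intro k
    induction k with
    | zero => simpa using hc
    | succ k ih =>
      rw [pow_succ, ← mul_assoc]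
      exact ih.contract hn ha hx (hx.trans hxy) (Pn_zero a x) (Pn_zero a y) xn yn
        (fun i => Pn_succ a i x) (fun i => Pn_succ a i y) xI yI
  have hone : ∀ k, 1 ≤ c * (x / y) ^ k := by
    intro k
    simpa [Pn_zero] using (hall k).2 0 (by omega)
  have hlim : Tendsto (fun k : ℕ => c * (x / y) ^ k) atTop (nhds (c * 0)) :=
    (tendsto_pow_atTop_nhds_zero_of_lt_one (div_nonneg hx.le (hx.trans hxy).le)
      ((div_lt_one (hx.trans hxy)).2 hxy)).const_mul c
  have := ge_of_tendsto' hlim hone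
  norm_num at this

/-! ### The length of a closing word is bounded below in terms of the parameter -/

/-- Words over the two maps `s ↦ r - α * s` and `s ↦ t - β * s` leading from `s` to `0` inside
the admissible region, together with the product of their slopes. -/
inductive DigitPath (t β r α : ℝ) : ℝ → ℝ → Prop
  | nil : DigitPath t β r α 0 1
  | long {s W : ℝ} : 0 ≤ s → α * s ≤ r → DigitPath t β r α (r - α * s) W →
      DigitPath t β r α s (α * W)
  | short {s W : ℝ} : 0 ≤ s → β * s ≤ t → β * (t - β * s) ≤ t → DigitPath t β r α (t - β * s) W →
      DigitPath t β r α s (β * W)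

/-- The numerical constraints relating the two maps of `DigitPath`. -/
structure Admissible (t β r α : ℝ) : Prop where
  t_pos : 0 < t
  one_lt : 1 < β
  le : β ≤ α
  rel : r * β ^ 2 = t * (β - 1) * α
  lt : (β - 1) * α < β

section DigitPath

variable {t β r α s W : ℝ}

lemma DigitPath.nonneg (h : DigitPath t β r α s W) : 0 ≤ s := by
  cases h <;> first | exact le_rfl | assumption

lemma DigitPath.one_le (h : DigitPath t β r α s W) (hβ : 1 ≤ β) (hα : 1 ≤ α) : 1 ≤ W := by
  induction h with
  | nil => exact le_rfl
  | long _ _ _ ih => exact one_le_mul_of_one_le_of_one_le hα ih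
  | short _ _ _ _ ih => exact one_le_mul_of_one_le_of_one_le hβ ih

namespace Admissible

lemma one_lt' (H : Admissible t β r α) : 1 < α := H.one_lt.trans_le H.le

lemma r_eq (H : Admissible t β r α) : r = t * (β - 1) * α / β ^ 2 := by
  have := H.one_lt
  rw [eq_div_iff (by positivity), H.rel]

lemma r_pos (H : Admissible t β r α) : 0 < r := by
  have h1 := H.one_lt
  have h2 := H.one_lt'
  have h3 := H.t_pos
  rw [H.r_eq]
  have : 0 < β - 1 := by linarith
  positivity

lemma short_pos (H : Admissible t β r α) : 0 < t - β * r := by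
  have h1 := H.one_lt
  have h3 := H.t_pos
  have h4 := H.lt
  have : t - β * r = t * (β - (β - 1) * α) / β := by
    rw [H.r_eq]; field_simp
  rw [this]
  have : 0 < β - (β - 1) * α := by linarith
  positivity

lemma next (H : Admissible t β r α) (hs : β ^ 2 * (α - 1) < 1) :
    Admissible r α (β ^ 2 * r - (β - 1) * t) (α * β ^ 2) where
  t_pos := H.r_pos
  one_lt := H.one_lt'
  le := by
    have h1 := H.one_lt
    have h2 := H.one_lt'
    exact le_mul_of_one_le_right (by linarith) (one_le_pow₀ h1.le)
  rel := by
    have h := H.rel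
    linear_combination (α ^ 2 - (α - 1) * α) * h
  lt := by
    have h2 := H.one_lt'
    nlinarith

/-- The two admissible regions only meet in one point. -/
lemma le_of_short (H : Admissible t β r α) (h : β * (t - β * s) ≤ t) : r ≤ α * s := by
  have h1 := H.one_lt
  have h2 := H.one_lt'
  have h3 := H.rel
  have : r * β ^ 2 ≤ α * s * β ^ 2 := by rw [h3]; nlinarith
  exact le_of_mul_le_mul_right this (by positivity)

lemma next_lt (H : Admissible t β r α) (hs : β ^ 2 * (α - 1) < 1) :
    α * (β ^ 2 * r - (β - 1) * t) < r := by
  have h1 := H.one_lt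
  have h2 := H.one_lt'
  have h3 := H.t_pos
  have e : β ^ 2 * r - (β - 1) * t = t * (β - 1) * (α - 1) := by linear_combination H.rel
  rw [e, H.r_eq, lt_div_iff₀ (by positivity)]
  have : 0 < t * (β - 1) * α := mul_pos (mul_pos h3 (by linarith)) (by linarith)
  nlinarith

lemma lt_short (H : Admissible t β r α) (hs : β ^ 2 * (α - 1) < 1) : r < α * (t - β * r) := by
  have h1 := H.one_lt
  have h2 := H.one_lt'
  have h3 := H.t_pos
  have e : β ^ 2 * (α * (t - β * r) - r) = t * α * (β ^ 2 - (β - 1) * (β * α) - (β - 1)) := by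
    linear_combination (-α * β - 1) * H.rel
  have h : 0 < β ^ 2 - (β - 1) * (β * α) - (β - 1) := by
    have : 0 < β * (β ^ 2 - (β - 1) * (β * α) - (β - 1)) := by nlinarith
    exact (mul_pos_iff_of_pos_left (by linarith)).1 this
  have : 0 < β ^ 2 * (α * (t - β * r) - r) := by rw [e]; positivity
  have := (mul_pos_iff_of_pos_left (by positivity)).1 this
  linarith

/-- A path can be parsed into the longer words of the next level. -/
lemma parse (H : Admissible t β r α) (hs : β ^ 2 * (α - 1) < 1) (h : DigitPath t β r α s W) :
    (α * s < r → DigitPath r α (β ^ 2 * r - (β - 1) * t) (α * β ^ 2) s W) ∧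
    (r ≤ α * s → s ≤ r →
      (α * s ≤ r ∧ DigitPath r α (β ^ 2 * r - (β - 1) * t) (α * β ^ 2) s W) ∨
      ∃ V, W = β ^ 2 * V ∧
        DigitPath r α (β ^ 2 * r - (β - 1) * t) (α * β ^ 2) (t - β * (t - β * s)) V) ∧
    (r < α * s → t - β * s ≤ β ^ 2 * r - (β - 1) * t →
      ∃ V, W = β * V ∧ DigitPath r α (β ^ 2 * r - (β - 1) * t) (α * β ^ 2) (t - β * s) V) := by
  have hr := H.r_pos
  have hα := H.one_lt'
  have hβ := H.one_lt
  induction h with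
  | nil =>
    refine ⟨fun _ => DigitPath.nil, fun h => ?_, fun h => ?_⟩ <;> · exfalso; linarith
  | @long s W h0 h1 _ ih =>
    obtain ⟨ih1, ih2, -⟩ := ih
    refine ⟨fun hlt => ?_, fun hge _ => ?_, fun hgt => absurd hgt h1.not_gt⟩
    · have hle : r - α * s ≤ r := by nlinarith
      rcases lt_or_ge (α * (r - α * s)) r with hc | hc
      · exact DigitPath.short h0 h1 hc.le (ih1 hc)
      · rcases ih2 hc hle with ⟨hc', hp⟩ | ⟨V, rfl, hp⟩
        · exact DigitPath.short h0 h1 hc' hp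
        · have e : t - β * (t - β * (r - α * s)) = β ^ 2 * r - (β - 1) * t - α * β ^ 2 * s := by
            ring
          rw [e] at hp
          rw [← mul_assoc]
          exact DigitPath.long h0 (by linarith [hp.nonneg]) hp
    · have e : r - α * s = 0 := by linarith
      rw [e] at ih1
      exact Or.inl ⟨h1, DigitPath.short h0 h1 (by rw [e]; linarith)
        (by rw [e]; exact ih1 (by linarith))⟩
  | @short s W h0 h1 h2 hp ih =>
    obtain ⟨ih1, -, ih3⟩ := ih
    refine ⟨fun hlt => absurd (H.le_of_short h2) hlt.not_ge, fun hge hle => Or.inr ?_,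
      fun hgt hle => ⟨W, rfl, ih1 ?_⟩⟩
    · have h3 : r < α * (t - β * s) := (H.lt_short hs).trans_le (by gcongr)
      obtain ⟨V, rfl, hV⟩ := ih3 h3 (by nlinarith)
      exact ⟨V, by ring, hV⟩
    · exact lt_of_le_of_lt (mul_le_mul_of_nonneg_left hle (by linarith)) (H.next_lt hs)

lemma two_le_of_large (H : Admissible t β r α) (hs : 1 ≤ β ^ 2 * (α - 1))
    (h : DigitPath t β r α 0 W) (hW : W ≠ 1) : 2 ≤ W := by
  have hr := H.r_pos
  have hα := H.one_lt'
  have hβ := H.one_lt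
  have hpos := H.short_pos
  have ht := H.t_pos
  generalize e : (0 : ℝ) = s at h
  cases h with
  | nil => exact absurd rfl hW
  | short _ _ h2 _ =>
    subst e
    nlinarith
  | @long _ W _ _ h =>
    subst e
    rw [mul_zero, sub_zero] at h
    generalize e : r = s at h
    cases h with
    | nil => linarith
    | long _ h1 _ =>
      subst e
      nlinarith
    | @short _ W _ _ _ h =>
      subst e
      have key : β ≤ W := by
        generalize e : t - β * r = s at h
        cases h with
        | nil => linarith
        | @long _ W _ _ h => nlinarith [h.one_le hβ.le hα.le, H.le]
        | @short _ W _ _ _ h => nlinarith [h.one_le hβ.le hα.le]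
      calc (2 : ℝ) ≤ α * (β * β) := by nlinarith
        _ ≤ α * (β * W) := by gcongr

lemma two_le (j : ℕ) : ∀ {t β r α : ℝ}, Admissible t β r α → DigitPath t β r α 0 W → W ≠ 1 →
    2 ≤ α * β ^ (2 * j) → 2 ≤ W := by
  induction j with
  | zero =>
    intro t β r α H h hW hα
    refine H.two_le_of_large ?_ h hW
    have := H.one_lt
    rw [mul_zero, pow_zero, mul_one] at hα
    nlinarith
  | succ j ih =>
    intro t β r α H h hW hj
    rcases le_or_gt 1 (β ^ 2 * (α - 1)) with hs | hs
    · exact H.two_le_of_large hs h hW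
    · refine ih (H.next hs) ((H.parse hs h).1 (by rw [mul_zero]; exact H.r_pos)) hW ?_
      have h1 := H.one_lt
      have h2 := H.le
      have h3 := H.one_lt'
      calc (2 : ℝ) ≤ α * β ^ (2 * (j + 1)) := hj
        _ = α * β ^ 2 * β ^ (2 * j) := by ring
        _ ≤ α * β ^ 2 * α ^ (2 * j) := by gcongr

end Admissible

end DigitPath

lemma add_one_le_pow_of_closing {a : ℕ → ℤ} (ha : ∀ i, 0 ≤ a i) {x : ℝ} (hx : 1 < x) {h : ℕ}
    (hh : 1 ≤ h) (I : ∀ j, j ≤ h → Pn a j x ∈ Set.Icc (0 : ℝ) 1) (hP : Pn a h x = 1) :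
    x + 1 ≤ x ^ (h + 1) := by
  suffices 2 ≤ x ^ h by rw [pow_succ]; nlinarith
  rcases le_or_gt 2 x with h2 | h2
  · exact h2.trans (le_self_pow₀ hx.le (by omega))
  have path : ∀ k, k ≤ h → DigitPath x x (x - 1) x (1 - Pn a (h - k) x) (x ^ k) := by
    intro k
    induction k with
    | zero => intro _; simpa [hP] using DigitPath.nil
    | succ k ih =>
      intro hk
      have hp := ih (by omega)
      obtain ⟨i, hi⟩ : ∃ i, h - k = i + 1 := ⟨h - k - 1, by omega⟩
      rw [show h - (k + 1) = i by omega, pow_succ']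
      rw [hi] at hp
      have I0 := I i (by omega)
      have I1 := I (i + 1) (by omega)
      rw [Pn_succ] at hp I1
      have hlt : a i < 2 := by
        have : (a i : ℝ) < 2 := by nlinarith [I0.2, I1.2]
        exact_mod_cast this
      have h0 := ha i
      obtain h' | h' : a i = 0 ∨ a i = 1 := by omega
      · rw [h'] at hp I1
        have e : (1 : ℝ) - ((0 : ℤ) + 1 - x * Pn a i x) = x - x * (1 - Pn a i x) := by
          push_cast; ring
        rw [e] at hp
        push_cast at I1
        exact DigitPath.short (by linarith [I0.2]) (by nlinarith [I0.1]) (by nlinarith [I1.1]) hp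
      · rw [h'] at hp I1
        have e : (1 : ℝ) - ((1 : ℤ) + 1 - x * Pn a i x) = x - 1 - x * (1 - Pn a i x) := by
          push_cast; ring
        rw [e] at hp
        push_cast at I1
        exact DigitPath.long (by linarith [I0.2]) (by nlinarith [I1.2]) hp
  have H : Admissible x x (x - 1) x :=
    ⟨by linarith, hx, le_rfl, by ring, by nlinarith⟩
  have p0 := path h le_rfl
  rw [Nat.sub_self, Pn_zero, sub_self] at p0
  obtain ⟨j, hj⟩ := pow_unbounded_of_one_lt 2 hx
  refine Admissible.two_le j H p0 (one_lt_pow₀ hx (by omega)).ne' ?_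
  have : x ^ j ≤ x ^ (2 * j) := pow_le_pow_right₀ hx.le (by omega)
  nlinarith

/-! ### Uniqueness of closing parameters: the general case -/

lemma exists_barrier {y δ : ℝ} (hy : 1 < y) {h : ℕ} (hyh : y + 1 ≤ y ^ (h + 1)) (hδ : δ ≠ 0) :
    ∃ m, 0 < m ∧ ∀ s s' : ℝ, s = 0 ∨ m ≤ s →
      (0 ≤ δ + (-y) ^ h * s ∧ s' = δ + (-y) ^ h * s) ∨
        (δ + (-y) ^ h * s ≤ 0 ∧ s' = -y * (δ + (-y) ^ h * s)) → m ≤ s' := by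
  have hp : 0 < y ^ h := by positivity
  rw [pow_succ] at hyh
  have h1 : 1 ≤ y ^ h := one_le_pow₀ hy.le
  rcases h.even_or_odd with he | he <;> rcases hδ.lt_or_gt with hd | hd
  · rw [he.neg_pow]
    refine ⟨-(y * δ), by nlinarith, ?_⟩
    rintro s s' (rfl | hs) (⟨h0, rfl⟩ | ⟨h0, rfl⟩)
    · nlinarith
    · nlinarith
    · nlinarith [mul_le_mul_of_nonneg_left hs hp.le]
    · nlinarith [mul_le_mul_of_nonneg_left hs hp.le]
  · rw [he.neg_pow]
    refine ⟨δ, hd, ?_⟩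
    rintro s s' (rfl | hs) (⟨h0, rfl⟩ | ⟨h0, rfl⟩)
    · nlinarith
    · nlinarith
    · nlinarith [mul_le_mul_of_nonneg_left hs hp.le]
    · nlinarith [mul_le_mul_of_nonneg_left hs hp.le]
  · rw [he.neg_pow]
    have hm : 0 < -(y * δ) := by nlinarith
    refine ⟨-(y * δ), hm, ?_⟩
    rintro s s' (rfl | hs) (⟨h0, rfl⟩ | ⟨h0, rfl⟩)
    · nlinarith
    · nlinarith
    · nlinarith [mul_nonneg hp.le (hm.le.trans hs)]
    · nlinarith [mul_nonneg hp.le (hm.le.trans hs)]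
  · rw [he.neg_pow]
    refine ⟨δ, hd, ?_⟩
    rintro s s' (rfl | hs) (⟨h0, rfl⟩ | ⟨h0, rfl⟩)
    · nlinarith
    · nlinarith
    · nlinarith [mul_le_mul_of_nonneg_left hs hp.le]
    · nlinarith [mul_le_mul_of_nonneg_left hs hp.le]

/-- After a return to `1`, the orbit of `x` repeats the first primitive block `b` of length
`m + 1`, up to lowering its last digit by one. -/
lemma digits_after_return {a b : ℕ → ℤ} {x : ℝ} {n m p : ℕ}
    (I : ∀ j, j ≤ n → Pn a j x ∈ Set.Icc (0 : ℝ) 1) (hn : Pn a n x = 1)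
    (bI : ∀ j, 1 ≤ j → j ≤ m → Pn b j x ∈ Set.Ioo (0 : ℝ) 1)
    (hp : p < n) (hP : Pn a p x = 1) : p + m < n ∧ ∀ i, i < m → a (p + i) = b i := by
  have key : ∀ k, k ≤ m → p + k ≤ n → ∀ i, i < k → a (p + i) = b i := by
    intro k
    induction k with
    | zero => intro _ _ i hi; omega
    | succ k ih =>
      intro hk hpk i hi
      have ih' := ih (by omega) (by omega)
      rcases Nat.lt_succ_iff_lt_or_eq.1 hi with hi | rfl
      · exact ih' i hi
      have e := Pn_add_sub ih' x
      rw [hP, sub_self, mul_zero, add_zero] at e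
      have e1 : Pn a (p + (i + 1)) x - Pn b (i + 1) x = ((a (p + i) - b i : ℤ) : ℝ) := by
        rw [← add_assoc, Pn_succ, Pn_succ, e]; push_cast; ring
      have hI := I _ hpk
      have hb := bI _ (by omega) hk
      have l1 : ((a (p + i) - b i : ℤ) : ℝ) < 1 := by rw [← e1]; linarith [hI.2, hb.1]
      have l2 : (-1 : ℝ) < ((a (p + i) - b i : ℤ) : ℝ) := by rw [← e1]; linarith [hI.1, hb.2]
      have l1' : a (p + i) - b i < 1 := by exact_mod_cast l1
      have l2' : -1 < a (p + i) - b i := by exact_mod_cast l2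
      omega
  have hlt : p + m < n := by
    by_contra! hge
    have hd := key (n - p) (by omega) (by omega)
    have e := Pn_add_sub hd x
    rw [hP, sub_self, mul_zero, add_zero, show p + (n - p) = n by omega, hn] at e
    exact (bI (n - p) (by omega) (by omega)).2.ne e.symm
  exact ⟨hlt, key m le_rfl hlt.le⟩

/-- Two distinct parameters cannot close up the same admissible word. -/
theorem closing_unique (n : ℕ) : ∀ {a : ℕ → ℤ}, (∀ i, 0 ≤ a i) → 1 ≤ n →
    ∀ {x y : ℝ}, 1 < x → x < y → (∀ j, j < n → Pn a j x ∈ Set.Icc (0 : ℝ) 1) →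
    (∀ j, j < n → Pn a j y ∈ Set.Icc (0 : ℝ) 1) →
    Pn a n x = 1 → Pn a n y = 1 → False := by
  induction n using Nat.strong_induction_on with
  | _ n ih =>
  intro a ha hn x y hx hxy xI' yI' xn yn
  have ext : ∀ z, (∀ j, j < n → Pn a j z ∈ Set.Icc (0 : ℝ) 1) → Pn a n z = 1 →
      ∀ j, j ≤ n → Pn a j z ∈ Set.Icc (0 : ℝ) 1 := by
    intro z hz hzn j hj
    rcases hj.lt_or_eq with hj | rfl
    · exact hz j hj
    · rw [hzn]; simp
  have xI := ext x xI' xn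
  have yI := ext y yI' yn
  by_cases hex : ∃ h, h + 1 < n ∧ (Pn a (h + 1) x = 0 ∨ Pn a (h + 1) x = 1)
  swap
  · refine false_of_primitive_closing ha hn (by linarith) hxy xI yI xn yn fun i hi hin => ?_
    obtain ⟨j, rfl⟩ : ∃ j, i = j + 1 := ⟨i - 1, by omega⟩
    exact ⟨fun h => hex ⟨j, hin, Or.inl h⟩, fun h => hex ⟨j, hin, Or.inr h⟩⟩
  obtain ⟨m, ⟨hmn, hm⟩, hmin⟩ : ∃ m, (m + 1 < n ∧ (Pn a (m + 1) x = 0 ∨ Pn a (m + 1) x = 1)) ∧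
      ∀ k, k < m → ¬(k + 1 < n ∧ (Pn a (k + 1) x = 0 ∨ Pn a (k + 1) x = 1)) := by
    classical
    exact ⟨Nat.find hex, Nat.find_spec hex, fun k hk => Nat.find_min hex hk⟩
  obtain ⟨b, hbi, hb0, hbx⟩ : ∃ b : ℕ → ℤ, (∀ i, i < m → b i = a i) ∧ (∀ i, 0 ≤ b i) ∧
      Pn b (m + 1) x = 1 := by
    rcases hm with h0 | h1
    · have hlt : ∀ i, i < m → Function.update a m (a m + 1) i = a i := fun i hi =>
        Function.update_of_ne (by omega) _ _
      refine ⟨Function.update a m (a m + 1), hlt, fun i => ?_, ?_⟩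
      · by_cases h : i = m
        · subst h; rw [Function.update_self]; linarith [ha i]
        · rw [Function.update_of_ne h]; exact ha i
      · rw [Pn_succ] at h0 ⊢
        rw [Pn_congr hlt, Function.update_self]
        push_cast
        linarith
    · exact ⟨a, fun _ _ => rfl, ha, h1⟩
  have hbP : ∀ z, ∀ j, j ≤ m → Pn b j z = Pn a j z := fun z j hj =>
    Pn_congr (fun i hi => hbi i (by omega)) z
  have bI : ∀ j, 1 ≤ j → j ≤ m → Pn b j x ∈ Set.Ioo (0 : ℝ) 1 := by
    intro j hj hjm
    rw [hbP x j hjm]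
    obtain ⟨k, rfl⟩ : ∃ k, j = k + 1 := ⟨j - 1, by omega⟩
    have h1 := hmin k (by omega)
    have h2 := xI (k + 1) (by omega)
    exact ⟨lt_of_le_of_ne h2.1 fun h => h1 ⟨by omega, Or.inl h.symm⟩,
      lt_of_le_of_ne h2.2 fun h => h1 ⟨by omega, Or.inr h⟩⟩
  have bIx : ∀ j, j < m + 1 → Pn b j x ∈ Set.Icc (0 : ℝ) 1 := fun j hj => by
    rw [hbP x j (by omega)]; exact xI j (by omega)
  have bIy : ∀ j, j < m + 1 → Pn b j y ∈ Set.Icc (0 : ℝ) 1 := fun j hj => by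
    rw [hbP y j (by omega)]; exact yI j (by omega)
  have hby : Pn b (m + 1) y ≠ 1 := fun h => ih (m + 1) hmn hb0 (by omega) hx hxy bIx bIy hbx h
  have growth : x + 1 ≤ x ^ (m + 1 + 1) := by
    refine add_one_le_pow_of_closing hb0 hx (by omega) (fun j hj => ?_) hbx
    rcases hj.lt_or_eq with hj | rfl
    · exact bIx j hj
    · rw [hbx]; simp
  have growth' : y + 1 ≤ y ^ (m + 1 + 1) := by
    have h1 : x ^ (m + 1) ≤ y ^ (m + 1) := by gcongr
    have h2 : 1 ≤ x ^ (m + 1) := one_le_pow₀ hx.le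
    rw [pow_succ] at growth ⊢
    nlinarith
  obtain ⟨μ, hμ, barrier⟩ := exists_barrier (δ := 1 - Pn b (m + 1) y) (hx.trans hxy) growth'
    (sub_ne_zero.2 hby.symm)
  have main : ∀ d p, p ≤ n → n - p ≤ d → Pn a p x = 1 → (p = 0 ∨ μ ≤ 1 - Pn a p y) → False := by
    intro d
    induction d with
    | zero =>
      intro p hp hd _ hs
      obtain rfl : p = n := by omega
      rw [yn] at hs
      rcases hs with h | h
      · omega
      · linarith
    | succ d ihd =>
      intro p hp hd hPp hs
      rcases hp.lt_or_eq with hpn | rfl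
      swap
      · exact ihd p le_rfl (by omega) hPp hs
      obtain ⟨hpm, hdig⟩ := digits_after_return xI xn bI hpn hPp
      have hs' : 1 - Pn a p y = 0 ∨ μ ≤ 1 - Pn a p y :=
        hs.imp (fun h => by rw [h, Pn_zero, sub_self]) id
      have ex : Pn a (p + m + 1) x = 1 + ((a (p + m) - b m : ℤ) : ℝ) := by
        have e := Pn_add_sub hdig x
        rw [hPp, sub_self, mul_zero, add_zero] at e
        rw [Pn_succ, e]
        rw [Pn_succ] at hbx
        push_cast
        linarith
      have ey : 1 - Pn a (p + m + 1) y = (1 - Pn b (m + 1) y) +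
          (-y) ^ (m + 1) * (1 - Pn a p y) - ((a (p + m) - b m : ℤ) : ℝ) := by
        have e := Pn_add_sub hdig y
        rw [Pn_succ, Pn_succ, e]
        push_cast
        ring
      have I1 := xI (p + m + 1) hpm
      have I2 := yI (p + m + 1) hpm
      have l1 : a (p + m) - b m ≤ 0 := by
        have : ((a (p + m) - b m : ℤ) : ℝ) ≤ 0 := by linarith [I1.2]
        exact_mod_cast this
      have l2 : -1 ≤ a (p + m) - b m := by
        have : (-1 : ℝ) ≤ ((a (p + m) - b m : ℤ) : ℝ) := by linarith [I1.1]
        exact_mod_cast this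
      obtain h | h : a (p + m) - b m = 0 ∨ a (p + m) - b m = -1 := by omega
      · rw [h] at ex ey
        push_cast at ex ey
        rw [sub_zero] at ey
        refine ihd (p + m + 1) hpm (by omega) (by rw [ex]; norm_num)
          (Or.inr (barrier _ _ hs' (Or.inl ⟨?_, ey⟩)))
        rw [← ey]
        linarith [I2.2]
      · rw [h] at ex ey
        push_cast at ex ey
        have hq : p + m + 1 < n := by
          rcases (Nat.succ_le_of_lt hpm).lt_or_eq with h | h
          · exact h
          · rw [Nat.succ_eq_add_one] at h
            rw [h, xn] at ex
            norm_num at ex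
        have ex' : Pn a (p + m + 1 + 1) x = a (p + m + 1) + 1 := by rw [Pn_succ, ex]; ring
        have I3 := xI (p + m + 1 + 1) hq
        have ha0 : a (p + m + 1) = 0 := by
          have : (a (p + m + 1) : ℝ) ≤ 0 := by linarith [I3.2]
          have : a (p + m + 1) ≤ 0 := by exact_mod_cast this
          exact le_antisymm this (ha _)
        refine ihd (p + m + 1 + 1) hq (by omega) (by rw [ex', ha0]; norm_num)
          (Or.inr (barrier _ _ hs' (Or.inr ⟨by linarith [I2.1], ?_⟩)))
        rw [Pn_succ, ha0]
        push_cast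
        linear_combination -y * ey
  exact main n 0 (by omega) (by omega) (Pn_zero a x) (Or.inl rfl)

/-! ### The sets `Jn` are intervals -/

lemma Jn_mem {a : ℕ → ℤ} {n : ℕ} {x : ℝ} (hx : x ∈ Jn a n) {j : ℕ} (hj : j ≤ n) :
    Pn a j x ∈ Set.Icc (0 : ℝ) 1 := by
  rcases Nat.eq_zero_or_pos j with rfl | h
  · simp [Pn_zero]
  · exact hx.2 j h hj

lemma Jn_anti {a : ℕ → ℤ} {m n : ℕ} (h : m ≤ n) : Jn a n ⊆ Jn a m :=
  fun _ hx => ⟨hx.1, fun j h1 h2 => hx.2 j h1 (h2.trans h)⟩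

lemma mem_Jn_succ {a : ℕ → ℤ} {n : ℕ} {x : ℝ} :
    x ∈ Jn a (n + 1) ↔ x ∈ Jn a n ∧ Pn a (n + 1) x ∈ Set.Icc (0 : ℝ) 1 := by
  refine ⟨fun h => ⟨Jn_anti n.le_succ h, Jn_mem h le_rfl⟩, fun h => ⟨h.1.1, fun j h1 h2 => ?_⟩⟩
  rcases h2.lt_or_eq with h2 | rfl
  · exact h.1.2 j h1 (by omega)
  · exact h.2

lemma Jn_congr {a b : ℕ → ℤ} {n : ℕ} (h : ∀ i, i < n → a i = b i) : Jn a n = Jn b n := by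
  ext x
  refine and_congr_right fun _ => forall_congr' fun j => forall_congr' fun _ =>
    forall_congr' fun hj => ?_
  rw [Pn_congr fun i hi => h i (hi.trans_le hj)]

lemma not_lt_of_closing {a : ℕ → ℤ} (ha : ∀ i, 0 ≤ a i) {n : ℕ} {x y : ℝ} (hx : x ∈ Jn a n)
    (hy : y ∈ Jn a n) {v : ℝ} (hv : v = 0 ∨ v = 1) (hxv : Pn a (n + 1) x = v)
    (hyv : Pn a (n + 1) y = v) : ¬ x < y := by
  intro hxy
  rcases hv with rfl | rfl
  · have hb : ∀ i, i < n → Function.update a n (a n + 1) i = a i := fun i hi =>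
      Function.update_of_ne (by omega) _ _
    have key : ∀ z, Pn a (n + 1) z = 0 → Pn (Function.update a n (a n + 1)) (n + 1) z = 1 := by
      intro z hz
      rw [Pn_succ] at hz ⊢
      rw [Pn_congr hb, Function.update_self]
      push_cast
      linarith
    refine closing_unique (n + 1) (a := Function.update a n (a n + 1)) (fun i => ?_) (by omega)
      hx.1 hxy (fun j hj => ?_) (fun j hj => ?_) (key x hxv) (key y hyv)
    · by_cases h : i = n
      · subst h; rw [Function.update_self]; linarith [ha i]
      · rw [Function.update_of_ne h]; exact ha i
    · rw [Pn_congr fun i hi => hb i (by omega)]; exact Jn_mem hx (by omega)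
    · rw [Pn_congr fun i hi => hb i (by omega)]; exact Jn_mem hy (by omega)
  · exact closing_unique (n + 1) ha (by omega) hx.1 hxy (fun j hj => Jn_mem hx (by omega))
      (fun j hj => Jn_mem hy (by omega)) hxv hyv

lemma ordConnected_Jn {a : ℕ → ℤ} (ha : ∀ i, 0 ≤ a i) (n : ℕ) : (Jn a n).OrdConnected := by
  induction n with
  | zero =>
    have : Jn a 0 = Set.Ioi 1 := by
      ext x
      exact ⟨fun h => h.1, fun h => ⟨h, fun j h1 h2 => by omega⟩⟩
    rw [this]
    exact Set.ordConnected_Ioi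
  | succ n ih =>
    refine ⟨fun x hx z hz y hy => ?_⟩
    have hx' := Jn_anti n.le_succ hx
    have hz' := Jn_anti n.le_succ hz
    have hy' := ih.out hx' hz' hy
    have hcont := continuous_Pn a (n + 1)
    have xI := Jn_mem hx le_rfl
    have zI := Jn_mem hz le_rfl
    refine mem_Jn_succ.2 ⟨hy', ?_, ?_⟩
    · by_contra! hneg
      obtain ⟨c, hc, hcv⟩ := intermediate_value_Icc' hy.1 hcont.continuousOn ⟨hneg.le, xI.1⟩
      obtain ⟨d, hd, hdv⟩ := intermediate_value_Icc hy.2 hcont.continuousOn ⟨hneg.le, zI.1⟩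
      have hcy : c < y := lt_of_le_of_ne hc.2 fun h => by rw [h] at hcv; linarith
      exact not_lt_of_closing ha (ih.out hx' hy' hc) (ih.out hy' hz' hd) (Or.inl rfl) hcv hdv
        (hcy.trans_le hd.1)
    · by_contra! hgt
      obtain ⟨c, hc, hcv⟩ := intermediate_value_Icc hy.1 hcont.continuousOn ⟨xI.2, hgt.le⟩
      obtain ⟨d, hd, hdv⟩ := intermediate_value_Icc' hy.2 hcont.continuousOn ⟨zI.2, hgt.le⟩
      have hcy : c < y := lt_of_le_of_ne hc.2 fun h => by rw [h] at hcv; linarith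
      exact not_lt_of_closing ha (ih.out hx' hy' hc) (ih.out hy' hz' hd) (Or.inr rfl) hcv hdv
        (hcy.trans_le hd.1)

/-! ### The next digit at an endpoint -/

/-- If `P_j(x)` is an endpoint of `[0, 1]` for some `j`, then condition (G) yields one of the two
inequalities defining `P_{n+1}(x) ∈ [0, 1]`. -/
lemma next_digit_of_endpoint {a : ℕ → ℤ} (ha : ∀ i, 0 ≤ a i) (hG : CondG a) {n : ℕ} {x : ℝ}
    (hx : x ∈ Jn a n) (d : ℕ) : ∀ j, 1 ≤ j → j + d = n →
    (Pn a j x = 1 → (Even d → (a n : ℝ) ≤ x * Pn a n x) ∧ (¬ Even d → x * Pn a n x ≤ a n + 1)) ∧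
    (Pn a j x = 0 → (Even d → x * Pn a n x ≤ a n + 1) ∧ (¬ Even d → (a n : ℝ) ≤ x * Pn a n x)) := by
  induction d using Nat.strong_induction_on with
  | _ d ih =>
  intro j hj hjd
  have digit : ∀ i, i < n → (a i : ℝ) ≤ x * Pn a i x ∧ x * Pn a i x ≤ a i + 1 := by
    intro i hi
    have h := Jn_mem hx (Nat.succ_le_of_lt hi)
    rw [Nat.succ_eq_add_one, Pn_succ] at h
    exact ⟨by linarith [h.2], by linarith [h.1]⟩
  constructor
  · intro h1
    -- `k` is either the first place where the shifted sequence differs, or `d`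
    have step : ∀ k, k < d → (∀ i, i < k → a (i + j) = a i) →
        (if Even k then a (k + j) < a k else a k < a (k + j)) →
        (Even d → (a n : ℝ) ≤ x * Pn a n x) ∧ (¬ Even d → x * Pn a n x ≤ a n + 1) := by
      intro k hk heq hlt
      have e := Pn_add_sub (a := a) (b := a) (p := j) (k := k)
        (fun i hi => by rw [add_comm]; exact heq i hi) x
      rw [h1, sub_self, mul_zero, add_zero] at e
      have e1 : Pn a (j + k + 1) x - Pn a (k + 1) x = ((a (k + j) - a k : ℤ) : ℝ) := by
        rw [Pn_succ, Pn_succ, e, add_comm j k]; push_cast; ring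
      have I1 := Jn_mem hx (j := k + 1) (by omega)
      have I2 := Jn_mem hx (j := j + k + 1) (by omega)
      have hrec := ih (d - k - 1) (by omega) (j + k + 1) (by omega) (by omega)
      split_ifs at hlt with hev
      · have h0 := (eq_one_and_eq_zero_of_sub_eq (d := -(a (k + j) - a k)) I1.2 I2.1
          (by push_cast at e1 ⊢; linarith) (by omega)).2
        have h3 := hrec.2 h0
        have par : Even (d - k - 1) ↔ ¬ Even d := by
          rw [Nat.even_iff] at hev
          rw [Nat.even_iff, Nat.even_iff]; omega
        rw [par, not_not] at h3
        exact ⟨h3.2, h3.1⟩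
      · have h0 := (eq_one_and_eq_zero_of_sub_eq I2.2 I1.1 e1 (by omega)).1
        have h3 := hrec.1 h0
        have par : Even (d - k - 1) ↔ Even d := by
          rw [Nat.even_iff] at hev
          rw [Nat.even_iff, Nat.even_iff]; omega
        rwa [par] at h3
    have last : (∀ i, i < d → a (i + j) = a i) → (Even d → a n ≤ a d) → (¬ Even d → a d ≤ a n) →
        (Even d → (a n : ℝ) ≤ x * Pn a n x) ∧ (¬ Even d → x * Pn a n x ≤ a n + 1) := by
      intro heq hev hodd
      have e := Pn_add_sub (a := a) (b := a) (p := j) (k := d)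
        (fun i hi => by rw [add_comm]; exact heq i hi) x
      rw [h1, sub_self, mul_zero, add_zero, hjd] at e
      have hd := digit d (by omega)
      rw [e]
      refine ⟨fun h => ?_, fun h => ?_⟩
      · have : (a n : ℝ) ≤ a d := by exact_mod_cast hev h
        linarith [hd.1]
      · have : (a d : ℝ) ≤ a n := by exact_mod_cast hodd h
        linarith [hd.2]
    have hdn : d + j = n := by omega
    rcases hG j hj with ⟨k, heq, hlt⟩ | heq
    · dsimp only at heq hlt
      rcases lt_trichotomy k d with hk | rfl | hk
      · exact step k hk heq hlt
      · rw [hdn] at hlt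
        refine last heq (fun h => ?_) (fun h => ?_)
        · rw [if_pos h] at hlt; exact hlt.le
        · rw [if_neg h] at hlt; exact hlt.le
      · have hd := heq d hk
        simp only [hdn] at hd
        exact last (fun i hi => heq i (hi.trans hk)) (fun _ => hd.le) (fun _ => hd.ge)
    · have hd := congrFun heq d
      simp only [hdn] at hd
      exact last (fun i _ => congrFun heq i) (fun _ => hd.le) (fun _ => hd.ge)
  · intro h0
    rcases Nat.eq_zero_or_pos d with rfl | hd
    · obtain rfl : j = n := by omega
      refine ⟨fun _ => ?_, fun h => absurd (by simp) h⟩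
      rw [h0, mul_zero]
      have : (0 : ℝ) ≤ a j := by exact_mod_cast ha j
      linarith
    · have I := Jn_mem hx (j := j + 1) (by omega)
      have haj : (0 : ℝ) ≤ a j := by exact_mod_cast ha j
      rw [Pn_succ, h0, mul_zero, sub_zero] at I
      have h1 : Pn a (j + 1) x = 1 := by
        rw [Pn_succ, h0]
        linarith [I.2]
      have h3 := (ih (d - 1) (by omega) (j + 1) (by omega) (by omega)).1 h1
      have par : Even (d - 1) ↔ ¬ Even d := by
        rw [Nat.even_iff, Nat.even_iff]; omega
      rw [par, not_not] at h3
      exact ⟨h3.2, h3.1⟩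

/-! ### The sequence `uSeq` is admissible for all parameters close to `1` -/

lemma uWord_add_two (k : ℕ) : uWord (k + 2) = uWord (k + 1) ++ (uWord k ++ uWord k) := by
  induction k with
  | zero => rfl
  | succ k ih =>
    calc uWord (k + 3) = (uWord (k + 2)).flatMap phiW := rfl
      _ = (uWord (k + 1) ++ (uWord k ++ uWord k)).flatMap phiW := by rw [ih]
      _ = uWord (k + 2) ++ (uWord (k + 1) ++ uWord (k + 1)) := by
        rw [List.flatMap_append, List.flatMap_append]; rfl

lemma uWord_prefix_succ (k : ℕ) : uWord k <+: uWord (k + 1) := by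
  cases k with
  | zero => exact ⟨[0, 0], rfl⟩
  | succ k => rw [uWord_add_two]; exact List.prefix_append _ _

lemma uWord_prefix_of_le {k l : ℕ} (h : k ≤ l) : uWord k <+: uWord l := by
  induction h with
  | refl => exact List.prefix_refl _
  | step _ ih => exact ih.trans (uWord_prefix_succ _)

lemma lt_length_uWord (k : ℕ) : k < (uWord k).length := by
  induction k with
  | zero => decide
  | succ k ih =>
    cases k with
    | zero => decide
    | succ k =>
      have : 0 < (uWord k).length :=
        List.length_pos_iff.2 fun h => by
          have := uWord_prefix_of_le (Nat.zero_le k)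
          rw [h] at this
          exact absurd (List.prefix_nil.1 this) (by decide)
      rw [uWord_add_two, List.length_append, List.length_append]
      omega

lemma uSeq_eq_getD {k i : ℕ} (h : i < (uWord k).length) : uSeq i = ((uWord k).getD i 0 : ℕ) := by
  have key : ∀ {l m : ℕ}, l ≤ m → i < (uWord l).length →
      (uWord l).getD i 0 = (uWord m).getD i 0 := by
    intro l m hlm hi
    obtain ⟨w, hw⟩ := uWord_prefix_of_le hlm
    rw [← hw, List.getD_append _ _ _ _ hi]
  have hi : i < (uWord (i + 1)).length := i.lt_succ_self.trans (lt_length_uWord _)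
  unfold uSeq
  rw [key (le_max_left (i + 1) k) hi, key (le_max_right (i + 1) k) h]

/-- The orbit of `s = 1 - P` along a digit word. -/
def runWord (x : ℝ) : List ℕ → ℝ → ℝ
  | [], s => s
  | c :: w, s => runWord x w (x - c - x * s)

/-- The orbit of `s = 1 - P` along a digit word stays in `[0, 1]`. -/
def StaysIn (x : ℝ) : List ℕ → ℝ → Prop
  | [], _ => True
  | c :: w, s => x - c - x * s ∈ Set.Icc (0 : ℝ) 1 ∧ StaysIn x w (x - c - x * s)

lemma runWord_append (x : ℝ) (v w : List ℕ) (s : ℝ) :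
    runWord x (v ++ w) s = runWord x w (runWord x v s) := by
  induction v generalizing s with
  | nil => rfl
  | cons c v ih => exact ih _

lemma staysIn_append {x : ℝ} {v w : List ℕ} {s : ℝ} :
    StaysIn x (v ++ w) s ↔ StaysIn x v s ∧ StaysIn x w (runWord x v s) := by
  induction v generalizing s with
  | nil => simp [StaysIn, runWord]
  | cons c v ih => simp [StaysIn, runWord, ih, and_assoc]

lemma StaysIn.Pn_mem {x : ℝ} {a : ℕ → ℤ} {w : List ℕ} {p : ℕ}
    (hw : ∀ i, i < w.length → a (p + i) = (w.getD i 0 : ℕ)) (h : StaysIn x w (1 - Pn a p x)) :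
    ∀ j, 1 ≤ j → j ≤ w.length → Pn a (p + j) x ∈ Set.Icc (0 : ℝ) 1 := by
  induction w generalizing p with
  | nil => intro j h1 h2; simp at h2; omega
  | cons c w ih =>
    obtain ⟨h1, h2⟩ := h
    have hc : a p = (c : ℕ) := by simpa using hw 0 (by simp)
    have e : x - c - x * (1 - Pn a p x) = 1 - Pn a (p + 1) x := by
      rw [Pn_succ, hc]; push_cast; ring
    rw [e] at h1 h2
    have ih' := ih (p := p + 1) (fun i hi => by
      have := hw (i + 1) (by simpa using hi)
      rw [List.getD_cons_succ] at this
      rw [← this]; congr 1; omega) h2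
    intro j hj hjl
    rcases hj.lt_or_eq with hj | rfl
    · have := ih' (j - 1) (by omega) (by simp at hjl; omega)
      rwa [show p + 1 + (j - 1) = p + j by omega] at this
    · exact ⟨by linarith [h1.2], by linarith [h1.1]⟩

/-- On `[0, t / β]` the word `w` acts as `s ↦ t - β * s` without leaving `[0, 1]`. -/
def SafeWord (x : ℝ) (w : List ℕ) (t β : ℝ) : Prop :=
  ∀ s, 0 ≤ s → β * s ≤ t → StaysIn x w s ∧ runWord x w s = t - β * s

lemma SafeWord.next {x t β r α : ℝ} {v w : List ℕ} (H : Admissible t β r α)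
    (hs : β ^ 2 * (α - 1) < 1) (hv : SafeWord x v t β) (hw : SafeWord x w r α) :
    SafeWord x (w ++ (v ++ v)) (β ^ 2 * r - (β - 1) * t) (α * β ^ 2) := by
  intro s h0 h1
  have hα := H.one_lt'
  have hβ := H.one_lt
  have hαs : 0 ≤ α * s := by positivity
  have h2 : α * s ≤ r := by
    have h3 := H.next_lt hs
    have h4 : 1 ≤ α * β ^ 2 := by nlinarith
    nlinarith
  obtain ⟨w1, w2⟩ := hw s h0 h2
  have h3 := H.short_pos
  obtain ⟨v1, v2⟩ := hv (r - α * s) (by linarith) (by nlinarith)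
  obtain ⟨v3, v4⟩ := hv (t - β * (r - α * s)) (by nlinarith) (by nlinarith)
  rw [staysIn_append, staysIn_append, runWord_append, runWord_append, w2, v2]
  exact ⟨⟨w1, v1, v3⟩, by rw [v4]; ring⟩

lemma eventually_safeWord (k : ℕ) : ∃ p q : ℕ, ∀ᶠ x : ℝ in nhdsWithin 1 (Set.Ioi 1), ∃ t r,
    Admissible t (x ^ p) r (x ^ q) ∧ SafeWord x (uWord k) t (x ^ p) ∧
      SafeWord x (uWord (k + 1)) r (x ^ q) := by
  induction k with
  | zero =>
    refine ⟨1, 3, ?_⟩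
    filter_upwards [Ioo_mem_nhdsGT (show (1 : ℝ) < 5 / 4 by norm_num)] with x hx
    obtain ⟨h1, h2⟩ := hx
    have h3 : 0 < x - 1 := by linarith
    refine ⟨x - 1, x * (x - 1) ^ 2, ⟨h3, by simpa using h1, ?_, by ring, ?_⟩, ?_, ?_⟩
    · exact pow_le_pow_right₀ h1.le (by norm_num)
    · have : (x - 1) * x ^ 2 < 1 := by nlinarith
      nlinarith
    · intro s h0 hs
      rw [pow_one] at hs ⊢
      have : 0 ≤ x * s := by positivity
      simp only [uWord, StaysIn, runWord, Set.mem_Icc]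
      push_cast
      exact ⟨⟨⟨by linarith, by linarith⟩, trivial⟩, rfl⟩
    · intro s h0 hs
      have hxs : 0 ≤ x * s := by positivity
      have hs1 : x * s ≤ x - 1 := by
        have : x ^ 2 * (x * s) ≤ x ^ 2 * (x - 1) := by nlinarith
        exact le_of_mul_le_mul_left this (by positivity)
      have hW : uWord (0 + 1) = [1, 0, 0] := rfl
      have h4 : x * (x - 1) ^ 2 ≤ 1 := by nlinarith
      have h5 : 0 ≤ x ^ 3 * s := by positivity
      have h6 : 0 ≤ x * (1 - (x - x * (x - 1 - x * s))) := by nlinarith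
      have h7 := (mul_nonneg_iff_of_pos_left (by linarith)).1 h6
      rw [hW]
      simp only [StaysIn, runWord, Set.mem_Icc]
      push_cast
      refine ⟨⟨⟨by linarith, by linarith⟩, ⟨by nlinarith, by linarith⟩, ⟨by linarith, ?_⟩, trivial⟩,
        by ring⟩
      nlinarith
  | succ k ih =>
    obtain ⟨p, q, h⟩ := ih
    refine ⟨q, q + 2 * p, ?_⟩
    have hlim : ∀ᶠ x : ℝ in nhdsWithin 1 (Set.Ioi 1), (x ^ p) ^ 2 * (x ^ q - 1) < 1 := by
      have hc : Continuous fun x : ℝ => (x ^ p) ^ 2 * (x ^ q - 1) := by fun_prop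
      exact (hc.continuousAt.eventually (gt_mem_nhds (by norm_num))).filter_mono nhdsWithin_le_nhds
    filter_upwards [h, hlim] with x hx hs
    obtain ⟨t, r, H, hv, hw⟩ := hx
    have e : x ^ (q + 2 * p) = x ^ q * (x ^ p) ^ 2 := by ring
    rw [e]
    refine ⟨r, _, H.next hs, hw, ?_⟩
    rw [uWord_add_two]
    exact hv.next H hs hw

lemma exists_subset_Jn_uSeq (n : ℕ) : ∃ c : ℝ, 1 < c ∧ Set.Ioo 1 c ⊆ Jn uSeq n := by
  obtain ⟨p, q, h⟩ := eventually_safeWord n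
  have h' : ∀ᶠ x : ℝ in nhdsWithin 1 (Set.Ioi 1), x ∈ Jn uSeq n := by
    filter_upwards [h, self_mem_nhdsWithin] with x hx hx1
    obtain ⟨t, r, H, hv, -⟩ := hx
    obtain ⟨hst, -⟩ := hv 0 le_rfl (by rw [mul_zero]; exact H.t_pos.le)
    refine ⟨hx1, fun j h1 h2 => ?_⟩
    have := StaysIn.Pn_mem (a := uSeq) (p := 0) (x := x) (w := uWord n)
      (fun i hi => by rw [zero_add]; exact uSeq_eq_getD hi) (by rwa [Pn_zero, sub_self]) j h1
      (h2.trans (lt_length_uWord n).le)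
    rwa [zero_add] at this
  obtain ⟨c, hc, hsub⟩ := mem_nhdsGT_iff_exists_Ioo_subset.1 h'
  exact ⟨c, hc, hsub⟩

/-! ### Nonemptiness -/

lemma exists_first_hit {f : ℝ → ℝ} (hf : Continuous f) {l r hi : ℝ} (hlr : l ≤ r) (hl : f l ≤ hi) :
    ∃ r', l ≤ r' ∧ r' ≤ r ∧ (∀ x ∈ Set.Icc l r', f x ≤ hi) ∧ (r' = r ∨ f r' = hi) := by
  by_cases hne : (Set.Icc l r ∩ {x | hi ≤ f x}).Nonempty
  · have hcomp : IsCompact (Set.Icc l r ∩ {x | hi ≤ f x}) :=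
      isCompact_Icc.inter_right (isClosed_le continuous_const hf)
    obtain ⟨⟨h1, h2⟩, h3⟩ := hcomp.sInf_mem hne
    have hmin : ∀ x, l ≤ x → x ≤ r → hi ≤ f x → sInf (Set.Icc l r ∩ {x | hi ≤ f x}) ≤ x :=
      fun x hx1 hx2 hx3 => csInf_le hcomp.bddBelow ⟨⟨hx1, hx2⟩, hx3⟩
    generalize sInf (Set.Icc l r ∩ {x | hi ≤ f x}) = r' at h1 h2 h3 hmin
    obtain ⟨c, hc, hcv⟩ := intermediate_value_Icc h1 hf.continuousOn ⟨hl, h3⟩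
    have hcr : c = r' := le_antisymm hc.2 (hmin c hc.1 (hc.2.trans h2) hcv.ge)
    rw [hcr] at hcv
    refine ⟨r', h1, h2, fun x hx => ?_, Or.inr hcv⟩
    rcases hx.2.lt_or_eq with h | rfl
    · by_contra! hgt
      exact absurd (hmin x hx.1 (hx.2.trans h2) hgt.le) h.not_ge
    · exact hcv.le
  · refine ⟨r, hlr, le_rfl, fun x hx => ?_, Or.inl rfl⟩
    by_contra! hgt
    exact hne ⟨x, hx, hgt.le⟩

lemma exists_subinterval {f : ℝ → ℝ} (hf : Continuous f) {l r lo hi : ℝ} (hlr : l ≤ r)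
    (hlh : lo ≤ hi) (hl : f l ≤ hi) (hr : lo ≤ f r) :
    ∃ l' r', l ≤ l' ∧ l' ≤ r' ∧ r' ≤ r ∧ (∀ x ∈ Set.Icc l' r', f x ∈ Set.Icc lo hi) ∧
      (l' = l ∨ f l' = lo) ∧ (r' = r ∨ f r' = hi) := by
  obtain ⟨r', h1, h2, h3, h4⟩ := exists_first_hit hf hlr hl
  have hr' : lo ≤ f r' := by
    rcases h4 with rfl | h4
    · exact hr
    · rw [h4]; exact hlh
  obtain ⟨s, k1, k2, k3, k4⟩ := exists_first_hit (f := fun x => -f (-x)) (by fun_prop)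
    (neg_le_neg h1) (hi := -lo) (by simpa using hr')
  refine ⟨-s, r', by linarith, by linarith, h2, fun x hx => ⟨?_, h3 x ⟨by linarith [hx.1], hx.2⟩⟩,
    k4.imp (fun h => by rw [h, neg_neg]) (fun h => by simpa using h), h4⟩
  have := k3 (-x) ⟨by linarith [hx.2], by linarith [hx.1]⟩
  simpa using this

/-- Either `n` is within the common prefix, or some `P_j` has reached the endpoint `v` of `[0, 1]`
for even `j`, or the endpoint `1 - v` for odd `j`. -/
def ReachedEndpoint (a : ℕ → ℤ) (n : ℕ) (v x : ℝ) : Prop :=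
  ∃ j, 1 ≤ j ∧ j ≤ n ∧ ((Even j ∧ Pn a j x = v) ∨ (¬ Even j ∧ Pn a j x = 1 - v))

lemma ReachedEndpoint.succ {a : ℕ → ℤ} {n : ℕ} {v x : ℝ} (h : ReachedEndpoint a n v x) :
    ReachedEndpoint a (n + 1) v x := by
  obtain ⟨j, h1, h2, h3⟩ := h
  exact ⟨j, h1, h2.trans n.le_succ, h3⟩

lemma ReachedEndpoint.zero_bound {a : ℕ → ℤ} (ha : ∀ i, 0 ≤ a i) (hG : CondG a) {n : ℕ} {x : ℝ}
    (hx : x ∈ Jn a n) (h : ReachedEndpoint a n 0 x) :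
    (Even n → x * Pn a n x ≤ a n + 1) ∧ (¬ Even n → (a n : ℝ) ≤ x * Pn a n x) := by
  obtain ⟨j, h1, h2, h3⟩ := h
  have key := next_digit_of_endpoint ha hG hx (n - j) j h1 (by omega)
  have par := Nat.even_sub h2
  rcases h3 with ⟨he, hv⟩ | ⟨ho, hv⟩
  · have := key.2 hv
    simp only [par, he, iff_true] at this
    exact this
  · have := key.1 (by rw [hv]; norm_num)
    simp only [par, ho, iff_false, not_not] at this
    exact ⟨this.2, this.1⟩

lemma ReachedEndpoint.one_bound {a : ℕ → ℤ} (ha : ∀ i, 0 ≤ a i) (hG : CondG a) {n : ℕ} {x : ℝ}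
    (hx : x ∈ Jn a n) (h : ReachedEndpoint a n 1 x) :
    (Even n → (a n : ℝ) ≤ x * Pn a n x) ∧ (¬ Even n → x * Pn a n x ≤ a n + 1) := by
  obtain ⟨j, h1, h2, h3⟩ := h
  have key := next_digit_of_endpoint ha hG hx (n - j) j h1 (by omega)
  have par := Nat.even_sub h2
  rcases h3 with ⟨he, hv⟩ | ⟨ho, hv⟩
  · have := key.1 hv
    simp only [par, he, iff_true] at this
    exact this
  · have := key.2 (by rw [hv]; norm_num)
    simp only [par, ho, iff_false, not_not] at this
    exact ⟨this.2, this.1⟩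

lemma Pn_sub_of_first_diff {a b : ℕ → ℤ} {m : ℕ} (h : ∀ i, i < m → a i = b i) (x : ℝ) :
    Pn a (m + 1) x - Pn b (m + 1) x = ((a m - b m : ℤ) : ℝ) := by
  rw [Pn_succ, Pn_succ, Pn_congr h]
  push_cast
  ring

/-- Induction step of the construction of nested intervals inside the sets `Jn a n`. -/
lemma exists_nested_step {a : ℕ → ℤ} {n : ℕ} {l r : ℝ} (hlr : l ≤ r) (hJ : Set.Icc l r ⊆ Jn a n)
    (hl : (Even n → l * Pn a n l ≤ a n + 1) ∧ (¬ Even n → (a n : ℝ) ≤ l * Pn a n l))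
    (hr : (Even n → (a n : ℝ) ≤ r * Pn a n r) ∧ (¬ Even n → r * Pn a n r ≤ a n + 1)) :
    ∃ l' r', l' ≤ r' ∧ Set.Icc l' r' ⊆ Jn a (n + 1) ∧
      (l' = l ∨ ReachedEndpoint a (n + 1) 0 l') ∧ (r' = r ∨ ReachedEndpoint a (n + 1) 1 r') := by
  have hc : Continuous fun x => x * Pn a n x := continuous_id.mul (continuous_Pn a n)
  have par : Even (n + 1) ↔ ¬ Even n := Nat.even_add_one
  by_cases hn : Even n
  · obtain ⟨l', r', h1, h2, h3, h4, h5, h6⟩ :=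
      exists_subinterval hc hlr (show (a n : ℝ) ≤ a n + 1 by linarith) (hl.1 hn) (hr.1 hn)
    refine ⟨l', r', h2, fun x hx => ?_, h5.imp id fun h => ?_, h6.imp id fun h => ?_⟩
    · have := h4 x hx
      refine mem_Jn_succ.2 ⟨hJ ⟨h1.trans hx.1, hx.2.trans h3⟩, ?_⟩
      rw [Pn_succ]
      exact ⟨by linarith [this.2], by linarith [this.1]⟩
    · exact ⟨n + 1, by omega, le_rfl, Or.inr ⟨by simpa [par] using hn, by rw [Pn_succ, h]; ring⟩⟩
    · exact ⟨n + 1, by omega, le_rfl, Or.inr ⟨by simpa [par] using hn, by rw [Pn_succ, h]; ring⟩⟩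
  · obtain ⟨l', r', h1, h2, h3, h4, h5, h6⟩ :=
      exists_subinterval (f := fun x => -(x * Pn a n x)) hc.neg hlr
        (show -(a n + 1 : ℝ) ≤ -a n by linarith) (neg_le_neg (hl.2 hn)) (neg_le_neg (hr.2 hn))
    refine ⟨l', r', h2, fun x hx => ?_, h5.imp id fun h => ?_, h6.imp id fun h => ?_⟩
    · have := h4 x hx
      refine mem_Jn_succ.2 ⟨hJ ⟨h1.trans hx.1, hx.2.trans h3⟩, ?_⟩
      rw [Pn_succ]
      exact ⟨by linarith [this.1], by linarith [this.2]⟩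
    · exact ⟨n + 1, by omega, le_rfl, Or.inl ⟨par.2 hn, by rw [Pn_succ]; linarith⟩⟩
    · exact ⟨n + 1, by omega, le_rfl, Or.inl ⟨par.2 hn, by rw [Pn_succ]; linarith⟩⟩

lemma Jn_nonempty {a : ℕ → ℤ} (ha : ∀ i, 0 ≤ a i) (hG : CondG a) (hL : CondL a) (n : ℕ) :
    (Jn a n).Nonempty := by
  obtain ⟨M, hM, hlt⟩ := hL
  obtain ⟨c, hc1, hc⟩ := exists_subset_Jn_uSeq (M + 1)
  obtain ⟨l₀, hl₀⟩ : (Set.Ioo 1 c).Nonempty := Set.nonempty_Ioo.2 hc1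
  have hu := hc hl₀
  have hM' : ∀ i, i < M → a i = uSeq i := fun i hi => (hM i hi).symm
  -- before the first difference, `l₀` satisfies all the constraints
  have common : ∀ i, i < M → Pn a (i + 1) l₀ ∈ Set.Icc (0 : ℝ) 1 := by
    intro i hi
    rw [Pn_congr fun k hk => hM' k (by omega)]
    exact Jn_mem hu (by omega)
  -- at the first difference, `l₀` lies on the correct side
  have side : (Even M → 1 ≤ Pn a (M + 1) l₀) ∧ (¬ Even M → Pn a (M + 1) l₀ ≤ 0) := by
    have e := Pn_sub_of_first_diff hM' l₀
    have I := Jn_mem hu le_rfl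
    refine ⟨fun h => ?_, fun h => ?_⟩
    · rw [if_pos h] at hlt
      have : (1 : ℝ) ≤ ((a M - uSeq M : ℤ) : ℝ) := by exact_mod_cast (by omega)
      linarith [I.1]
    · rw [if_neg h] at hlt
      have : ((a M - uSeq M : ℤ) : ℝ) ≤ -1 := by exact_mod_cast (by omega)
      linarith [I.2]
  suffices h : ∃ l r, l ≤ r ∧ Set.Icc l r ⊆ Jn a n ∧
      (ReachedEndpoint a n 0 l ∨ (n ≤ M ∧ l = l₀)) ∧
      (ReachedEndpoint a n 1 r ∨ (n = 0 ∧ (a 0 : ℝ) + 2 ≤ r)) by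
    obtain ⟨l, r, hlr, hJ, -⟩ := h
    exact ⟨l, hJ ⟨le_rfl, hlr⟩⟩
  induction n with
  | zero =>
    exact ⟨l₀, max l₀ (a 0 + 2), le_max_left _ _,
      fun x hx => ⟨hl₀.1.trans_le hx.1, fun j h1 h2 => by omega⟩,
      Or.inr ⟨by omega, rfl⟩, Or.inr ⟨rfl, le_max_right _ _⟩⟩
  | succ n ih =>
    obtain ⟨l, r, hlr, hJ, hleft, hright⟩ := ih
    have hl : (Even n → l * Pn a n l ≤ a n + 1) ∧ (¬ Even n → (a n : ℝ) ≤ l * Pn a n l) := by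
      rcases hleft with h | ⟨hnM, rfl⟩
      · exact h.zero_bound ha hG (hJ ⟨le_rfl, hlr⟩)
      · rcases hnM.lt_or_eq with h | rfl
        · have := common n h
          rw [Pn_succ] at this
          exact ⟨fun _ => by linarith [this.1], fun _ => by linarith [this.2]⟩
        · rw [Pn_succ] at side
          exact ⟨fun h => by linarith [side.1 h], fun h => by linarith [side.2 h]⟩
    have hr : (Even n → (a n : ℝ) ≤ r * Pn a n r) ∧ (¬ Even n → r * Pn a n r ≤ a n + 1) := by
      rcases hright with h | ⟨rfl, h⟩
      · exact h.one_bound ha hG (hJ ⟨hlr, le_rfl⟩)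
      · refine ⟨fun _ => ?_, fun h => absurd (by simp) h⟩
        rw [Pn_zero]
        linarith
    obtain ⟨l', r', hlr', hJ', hl', hr'⟩ := exists_nested_step hlr hJ hl hr
    refine ⟨l', r', hlr', hJ', ?_, ?_⟩
    · rcases hl' with rfl | h
      · rcases hleft with h | ⟨hnM, rfl⟩
        · exact Or.inl h.succ
        · rcases hnM.lt_or_eq with h | rfl
          · exact Or.inr ⟨h, rfl⟩
          · have I := Jn_mem (hJ' ⟨le_rfl, hlr'⟩) le_rfl
            have par : Even (n + 1) ↔ ¬ Even n := Nat.even_add_one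
            refine Or.inl ⟨n + 1, by omega, le_rfl, ?_⟩
            by_cases h : Even n
            · exact Or.inr ⟨by simpa [par] using h, by linarith [side.1 h, I.2]⟩
            · exact Or.inl ⟨par.2 h, le_antisymm (side.2 h) I.1⟩
      · exact Or.inl h
    · rcases hr' with rfl | h
      · rcases hright with h | ⟨rfl, h⟩
        · exact Or.inl h.succ
        · have I := Jn_mem (hJ' ⟨hlr', le_rfl⟩) le_rfl
          rw [Pn_succ, Pn_zero] at I
          linarith [I.1]
      · exact Or.inl h

/-! ### The infimum of `Jn` -/

lemma sInf_Jn_eq_one_iff {a : ℕ → ℤ} (ha : ∀ i, 0 ≤ a i) (hG : CondG a) (hL : CondL a) (n : ℕ) :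
    sInf (Jn a n) = 1 ↔ ∀ i, i < n → a i = uSeq i := by
  have hne := Jn_nonempty ha hG hL n
  have hbdd : BddBelow (Jn a n) := ⟨1, fun x hx => hx.1.le⟩
  constructor
  · intro hinf
    by_contra hneq
    obtain ⟨M, hM, hlt⟩ := hL
    have hM' : ∀ i, i < M → a i = uSeq i := fun i hi => (hM i hi).symm
    have hMn : M < n := by
      by_contra! h
      exact hneq fun i hi => hM' i (hi.trans_le h)
    obtain ⟨c, hc1, hc⟩ := exists_subset_Jn_uSeq (M + 1)
    obtain ⟨v, hv, key⟩ : ∃ v : ℝ, (v = 0 ∨ v = 1) ∧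
        ∀ x ∈ Jn a n, x < c → Pn a (M + 1) x = v := by
      have e := Pn_sub_of_first_diff hM'
      by_cases h : Even M
      · rw [if_pos h] at hlt
        exact ⟨1, Or.inr rfl, fun x hx hxc => (eq_one_and_eq_zero_of_sub_eq
          (Jn_mem hx (by omega)).2 (Jn_mem (hc ⟨hx.1, hxc⟩) le_rfl).1 (e x) (by omega)).1⟩
      · rw [if_neg h] at hlt
        refine ⟨0, Or.inl rfl, fun x hx hxc => (eq_one_and_eq_zero_of_sub_eq
          (d := -(a M - uSeq M)) (Jn_mem (hc ⟨hx.1, hxc⟩) le_rfl).2 (Jn_mem hx (by omega)).1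
          ?_ (by omega)).2⟩
        have := e x
        push_cast at this ⊢
        linarith
    obtain ⟨y, hy, hyc⟩ := exists_lt_of_csInf_lt hne (by rwa [hinf])
    obtain ⟨z, hz, hzy⟩ := exists_lt_of_csInf_lt hne (by rw [hinf]; exact hy.1)
    exact not_lt_of_closing ha (Jn_anti hMn.le hz) (Jn_anti hMn.le hy) hv
      (key z hz (hzy.trans hyc)) (key y hy hyc) hzy
  · intro heq
    obtain ⟨c, hc1, hc⟩ := exists_subset_Jn_uSeq n
    rw [← Jn_congr heq] at hc
    refine le_antisymm ?_ (le_csInf hne fun x hx => hx.1.le)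
    refine (csInf_le_csInf hbdd (Set.nonempty_Ioo.2 hc1) hc).trans ?_
    rw [csInf_Ioo hc1]

/-- under (G) and (L), every J_n is a nonempty interval, and
inf J_n = 1 iff a_1⋯a_n = u_1⋯u_n. -/
theorem stmt_13 (a : ℕ → ℤ) (hpos : ∀ n, 0 ≤ a n) (hG : CondG a) (hL : CondL a)
    (n : ℕ) (hn : 1 ≤ n) :
    (Jn a n).Nonempty ∧ (Jn a n).OrdConnected ∧
      (sInf (Jn a n) = 1 ↔ ∀ i, i < n → a i = uSeq i) := by
  exact ⟨Jn_nonempty hpos hG hL n, ordConnected_Jn hpos n, sInf_Jn_eq_one_iff hpos hG hL n⟩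
end
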